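/- arXiv:math/0701038 — 2 statements merged into one kernel-verified Lean document; each statement's English description precedes it below -/
import Mathlib

section
/- For 1 ≤ i < j ≤ 7, the complexes N_i and N_j are not properly bistellar equivalent, i.e., N_j cannot be obtained from N_i by a finite sequence of proper bistellar moves (even up to isomorphism). -/
/-! Basic framework for finite simplicial complexes, pseudomanifolds and
bistellar moves, following Datta–Nilakantan. A complex is recorded as the
finite set of its faces (nonempty finite subsets of the vertex type). -/

namespace NPM

variable {α β : Type*} [DecidableEq α] [DecidableEq β]

/-- A "complex" datum: a finite family of finite subsets of `α`. -/
abbrev Complex (α : Type*) := Finset (Finset α)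

/-- `K` is a simplicial complex: a nonempty collection of nonempty sets,
closed under passing to nonempty subsets. -/
def IsComplex (K : Complex α) : Prop :=
  K.Nonempty ∧ (∀ σ ∈ K, σ.Nonempty) ∧ ∀ σ ∈ K, ∀ τ ⊆ σ, τ.Nonempty → τ ∈ K

/-- The vertex set of `K`. -/
def verts (K : Complex α) : Finset α := K.sup id

/-- `K` is pure of dimension `d`: every face is contained in a face with
`d+1` vertices. -/
def IsPure (K : Complex α) (d : ℕ) : Prop :=
  ∀ σ ∈ K, ∃ τ ∈ K, σ ⊆ τ ∧ τ.card = d + 1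

/-- The facets ("`d`-faces") of a pure `d`-dimensional complex. -/
def facets (K : Complex α) (d : ℕ) : Complex α := K.filter (fun σ => σ.card = d + 1)

/-- The link of a face `σ` in `K`. -/
def link (K : Complex α) (σ : Finset α) : Complex α :=
  K.filter (fun τ => Disjoint τ σ ∧ σ ∪ τ ∈ K)

/-- The degree of a face: the number of vertices of its link. -/
def degree (K : Complex α) (σ : Finset α) : ℕ := (verts (link K σ)).card

/-- A weak `d`-pseudomanifold: a pure `d`-dimensional complex in which every
`(d-1)`-face (i.e. face with `d` vertices) lies in exactly two facets. -/
def WeakPM (K : Complex α) (d : ℕ) : Prop :=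
  IsComplex K ∧ IsPure K d ∧
    ∀ σ ∈ K, σ.card = d → (K.filter fun τ => σ ⊆ τ ∧ τ.card = d + 1).card = 2

/-- Strong connectedness: any two facets are joined by a chain of facets in
which consecutive facets meet in a `(d-1)`-face. -/
def SConn (K : Complex α) (d : ℕ) : Prop :=
  ∀ σ ∈ facets K d, ∀ τ ∈ facets K d,
    Relation.ReflTransGen
      (fun a b => a ∈ facets K d ∧ b ∈ facets K d ∧ (a ∩ b).card = d) σ τ

/-- A `d`-pseudomanifold: a strongly connected weak `d`-pseudomanifold. -/
def IsPM (K : Complex α) (d : ℕ) : Prop := WeakPM K d ∧ SConn K d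

/-- Connectedness of a complex: the graph of vertices and edges is connected. -/
def Conn (K : Complex α) : Prop :=
  (verts K).Nonempty ∧ ∀ u ∈ verts K, ∀ v ∈ verts K,
    Relation.ReflTransGen (fun a b => a ≠ b ∧ ({a, b} : Finset α) ∈ K) u v

/-- A normal `d`-pseudomanifold: a connected weak `d`-pseudomanifold in which
the link of every face of dimension `≤ d - 2` is connected. -/
def NormalPM (K : Complex α) (d : ℕ) : Prop :=
  WeakPM K d ∧ Conn K ∧ ∀ σ ∈ K, σ.card + 1 ≤ d → Conn (link K σ)

/-- `K` is neighbourly: every pair of vertices forms an edge. -/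
def Neighbourly (K : Complex α) : Prop :=
  ∀ u ∈ verts K, ∀ v ∈ verts K, u ≠ v → ({u, v} : Finset α) ∈ K

/-- Isomorphism of complexes: a map injective on the vertex set carrying the
faces of `K` exactly onto the faces of `L`. -/
def Iso (K : Complex α) (L : Complex β) : Prop :=
  ∃ f : α → β, Set.InjOn f ↑(verts K) ∧ L = K.image (fun σ => σ.image f)

/-- The complex generated by a family of facets: all nonempty subsets. -/
def genCx (F : Finset (Finset α)) : Complex α :=
  F.biUnion fun σ => σ.powerset.filter (fun τ => τ.Nonempty)

/-- The standard sphere on the vertex set `B`: all nonempty proper subsets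
of `B`. -/
def stdSphere (B : Finset α) : Complex α :=
  B.powerset.filter fun τ => τ.Nonempty ∧ τ ≠ B

/-- In a weak `d`-pseudomanifold, a removable `(d-i)`-face `A`: its link is a
standard sphere `S^{i-1}_{i+1}(B)` with `B` not a face.  (For `d = 3`,
`i = 1` gives removable 2-faces and `i = 2` gives removable 1-faces.) -/
def RemovableFace (d i : ℕ) (K : Complex α) (A : Finset α) : Prop :=
  A ∈ K ∧ A.card = d - i + 1 ∧
    ∃ B : Finset α, B.card = i + 1 ∧ B ∉ K ∧ link K A = stdSphere B

/-- The bistellar `i`-move (`0 < i ≤ d`) relation on weak `d`-pseudomanifolds: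
`L` is obtained from `K` by removing a removable `(d-i)`-face `A` with
`link K A = stdSphere B` and inserting the facets `(B ∪ A) \ {v}`, `v ∈ A`. -/
def BMove (d i : ℕ) (K L : Complex α) : Prop :=
  ∃ A B : Finset α, A ∈ K ∧ A.card = d - i + 1 ∧ B.card = i + 1 ∧ B ∉ K ∧
    link K A = stdSphere B ∧
    L = genCx ((facets K d).filter (fun σ => ¬ A ⊆ σ) ∪
          A.image fun v => (B ∪ A).erase v)

/-- The bistellar `0`-move: star a new vertex `w` in a facet `σ`. -/
def BMove0 (d : ℕ) (K L : Complex α) : Prop :=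
  ∃ σ w, σ ∈ K ∧ σ.card = d + 1 ∧ w ∉ verts K ∧
    L = genCx (((facets K d).erase σ) ∪ σ.image fun v => insert w (σ.erase v))

/-- A single bistellar move of any type `0 ≤ i ≤ d`. -/
def BStep (d : ℕ) (K L : Complex α) : Prop :=
  BMove0 d K L ∨ ∃ i, 0 < i ∧ i ≤ d ∧ BMove d i K L

/-- Bistellar equivalence: a finite sequence of bistellar moves. -/
def BEquiv (d : ℕ) : Complex α → Complex α → Prop :=
  Relation.ReflTransGen (BStep d)

/-- A proper bistellar move: a bistellar `i`-move with `0 < i < d`. -/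
def PMove (d : ℕ) (K L : Complex α) : Prop := ∃ i, 0 < i ∧ i < d ∧ BMove d i K L

/-- Proper bistellar equivalence. -/
def PEquiv (d : ℕ) : Complex α → Complex α → Prop :=
  Relation.ReflTransGen (PMove d)

/-- The result of the bistellar move on the face `A` of the weak
`d`-pseudomanifold `K` (deterministic form: `B` is the vertex set of
`link K A`). -/
def kappa (d : ℕ) (K : Complex α) (A : Finset α) : Complex α :=
  genCx ((facets K d).filter (fun σ => ¬ A ⊆ σ) ∪
    A.image fun v => (verts (link K A) ∪ A).erase v)

/-- A cycle: a (finite) 1-pseudomanifold. -/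
def Cycle (K : Complex α) : Prop := IsPM K 1

/-- A combinatorial 2-manifold: a weak 2-pseudomanifold all whose vertex
links are cycles. -/
def Comb2Mfd (K : Complex α) : Prop :=
  WeakPM K 2 ∧ ∀ v, ({v} : Finset α) ∈ K → Cycle (link K {v})

/-- The Euler characteristic `f₀ - f₁ + f₂` of a 2-dimensional complex. -/
def eulerChar (K : Complex α) : ℤ :=
  ((K.filter fun σ => σ.card = 1).card : ℤ) -
    ((K.filter fun σ => σ.card = 2).card : ℤ) +
    ((K.filter fun σ => σ.card = 3).card : ℤ)

/-- A combinatorial 2-sphere: a connected combinatorial 2-manifold with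
Euler characteristic 2. -/
def Comb2Sphere (K : Complex α) : Prop := Comb2Mfd K ∧ Conn K ∧ eulerChar K = 2

/-- A combinatorial 3-manifold: a 3-pseudomanifold all whose vertex links are
combinatorial 2-spheres. -/
def Comb3Mfd (K : Complex α) : Prop :=
  IsPM K 3 ∧ ∀ v, ({v} : Finset α) ∈ K → Comb2Sphere (link K {v})

end NPM

/-- The complex `N1` from the paper, generated by its facets. -/
def N1 : NPM.Complex ℕ :=
  NPM.genCx {{1,2,4,8}, {1,2,6,8}, {1,3,4,8}, {1,3,7,8}, {1,5,6,8}, {1,5,7,8}, {2,3,5,8}, {2,3,7,8}, {2,4,5,8}, {2,6,7,8}, {3,4,6,8}, {3,5,6,8}, {4,5,7,8}, {4,6,7,8}, {1,2,4,7}, {1,2,5,7}, {1,3,6,7}, {1,4,6,7}, {2,3,4,7}, {2,5,6,7}, {3,4,5,7}, {3,5,6,7}, {1,2,3,6}, {2,3,4,6}, {1,3,4,5}, {1,2,3,5}, {1,4,5,6}, {2,4,5,6}}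
/-- The complex `N2` from the paper, generated by its facets. -/
def N2 : NPM.Complex ℕ :=
  NPM.genCx {{1,2,4,8}, {2,4,5,8}, {2,3,5,8}, {3,5,6,8}, {3,4,6,8}, {4,6,7,8}, {4,5,7,8}, {1,5,7,8}, {1,5,6,8}, {1,2,6,8}, {2,6,7,8}, {2,3,7,8}, {1,3,7,8}, {1,3,4,8}, {1,2,4,7}, {2,4,5,7}, {2,3,5,7}, {3,5,6,7}, {3,4,6,7}, {1,5,6,7}, {1,2,6,7}, {1,3,4,7}}
/-- The complex `N3` from the paper, generated by its facets. -/
def N3 : NPM.Complex ℕ :=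
  NPM.genCx {{1,2,4,8}, {1,2,6,8}, {1,3,4,8}, {1,3,7,8}, {1,5,6,8}, {1,5,7,8}, {2,3,5,8}, {2,3,7,8}, {2,4,5,8}, {2,6,7,8}, {3,4,6,8}, {3,5,6,8}, {4,5,7,8}, {4,6,7,8}, {1,2,3,4}, {2,3,4,7}, {2,4,5,6}, {2,4,6,7}, {3,4,5,6}, {3,4,5,7}, {1,2,3,5}, {1,2,5,6}, {1,3,5,7}}
/-- The complex `N4` from the paper, generated by its facets. -/
def N4 : NPM.Complex ℕ :=
  NPM.genCx {{1,2,4,8}, {1,2,6,8}, {1,3,4,8}, {1,3,7,8}, {1,5,6,8}, {1,5,7,8}, {2,3,5,8}, {2,3,7,8}, {2,4,5,8}, {2,6,7,8}, {3,4,6,8}, {3,5,6,8}, {4,5,7,8}, {4,6,7,8}, {1,2,4,5}, {1,2,5,6}, {2,3,5,6}, {2,3,6,7}, {3,4,6,7}, {1,3,4,7}, {1,4,5,7}}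
/-- The complex `N5` from the paper, generated by its facets. -/
def N5 : NPM.Complex ℕ :=
  NPM.genCx {{1,2,5,8}, {1,2,6,8}, {1,3,5,8}, {1,3,7,8}, {1,4,6,8}, {1,4,7,8}, {2,3,6,8}, {2,3,7,8}, {2,4,5,8}, {2,4,7,8}, {3,4,5,8}, {3,4,6,8}, {1,2,5,7}, {1,2,6,7}, {1,3,6,7}, {1,4,5,7}, {2,3,5,7}, {2,4,6,7}, {3,4,5,7}, {3,4,6,7}, {2,3,5,6}, {2,4,5,6}, {1,3,5,6}, {1,4,5,6}}
/-- The complex `N6` from the paper, generated by its facets. -/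
def N6 : NPM.Complex ℕ :=
  NPM.genCx {{1,3,5,8}, {1,3,7,8}, {1,4,6,8}, {1,4,7,8}, {1,5,6,8}, {2,3,6,8}, {2,3,7,8}, {2,4,5,8}, {2,4,7,8}, {2,5,6,8}, {3,4,5,8}, {3,4,6,8}, {1,2,3,5}, {1,2,4,5}, {1,4,5,7}, {1,5,6,7}, {2,3,5,7}, {2,5,6,7}, {3,4,5,7}, {1,2,3,6}, {1,2,4,6}, {1,3,6,7}, {2,4,6,7}, {3,4,6,7}}
/-- The complex `N7` from the paper, generated by its facets. -/
def N7 : NPM.Complex ℕ :=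
  NPM.genCx {{1,2,6,8}, {1,2,5,8}, {1,3,5,8}, {1,3,7,8}, {1,4,7,8}, {1,4,6,8}, {2,3,7,8}, {2,3,6,8}, {2,4,5,8}, {2,4,7,8}, {3,4,6,8}, {3,4,5,8}, {1,3,5,6}, {1,3,6,7}, {2,3,5,7}, {2,3,5,6}, {3,4,6,7}, {3,4,5,7}, {1,2,5,6}, {1,4,6,7}, {2,4,5,7}}

namespace NPM

section

variable {α β : Type*} [DecidableEq α] [DecidableEq β]

lemma mem_genCx {F : Finset (Finset α)} {σ : Finset α} :
    σ ∈ genCx F ↔ σ.Nonempty ∧ ∃ τ ∈ F, σ ⊆ τ := by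
  simp only [genCx, Finset.mem_biUnion, Finset.mem_filter, Finset.mem_powerset]
  tauto

lemma subset_verts {K : Complex α} {σ : Finset α} (h : σ ∈ K) : σ ⊆ verts K :=
  Finset.le_sup (f := id) h

lemma mem_verts {K : Complex α} {x : α} : x ∈ verts K ↔ ∃ σ ∈ K, x ∈ σ := by
  simp [verts, Finset.mem_sup]

/-- The sum of `|σ ∩ τ|³` over all ordered pairs of members of a family of finite sets. -/
def interCubeSum (F : Finset (Finset α)) : ℕ :=
  ∑ σ ∈ F, ∑ τ ∈ F, (σ ∩ τ).card ^ 3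

lemma interCubeSum_facets_eq_of_iso {K : Complex α} {L : Complex β} (d : ℕ) (h : Iso K L) :
    interCubeSum (facets K d) = interCubeSum (facets L d) := by
  obtain ⟨f, hf, rfl⟩ := h
  have hcard {σ : Finset α} (hσ : σ ∈ K) : (σ.image f).card = σ.card :=
    Finset.card_image_of_injOn (hf.mono (Finset.coe_subset.2 (subset_verts hσ)))
  have hinter {σ τ : Finset α} (hσ : σ ∈ K) (hτ : τ ∈ K) :
      (σ.image f ∩ τ.image f).card = (σ ∩ τ).card := by
    have hσ' := Finset.coe_subset.2 (subset_verts hσ)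
    have hτ' := Finset.coe_subset.2 (subset_verts hτ)
    rw [← Finset.image_inter_of_injOn _ _ (hf.mono (Set.union_subset hσ' hτ'))]
    exact Finset.card_image_of_injOn
      (hf.mono (Finset.coe_subset.2 (Finset.inter_subset_left.trans (subset_verts hσ))))
  have hinj : Set.InjOn (Finset.image f) (K : Set (Finset α)) := by
    intro σ hσ τ hτ h
    have hi := hinter hσ hτ
    have hi' := hinter hσ hτ
    rw [h, Finset.inter_self, hcard hτ] at hi
    rw [← h, Finset.inter_self, hcard hσ] at hi'
    exact (Finset.eq_of_subset_of_card_le Finset.inter_subset_left hi'.le).symm.trans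
      (Finset.eq_of_subset_of_card_le Finset.inter_subset_right hi.le)
  have hfac : facets (K.image (Finset.image f)) d = (facets K d).image (Finset.image f) := by
    unfold facets
    rw [Finset.filter_image, Finset.filter_congr fun σ hσ => by rw [hcard hσ]]
  have hinj' : Set.InjOn (Finset.image f) (facets K d : Set (Finset α)) :=
    hinj.mono (Finset.coe_subset.2 (Finset.filter_subset _ _))
  unfold interCubeSum
  rw [hfac, Finset.sum_image hinj']
  refine Finset.sum_congr rfl fun σ hσ => ?_
  rw [Finset.sum_image hinj']
  exact Finset.sum_congr rfl fun τ hτ => by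
    rw [hinter (Finset.mem_filter.1 hσ).1 (Finset.mem_filter.1 hτ).1]

lemma facets_genCx {F : Finset (Finset α)} {d : ℕ} (hF : ∀ σ ∈ F, σ.card = d + 1) :
    facets (genCx F) d = F := by
  ext σ
  simp only [facets, Finset.mem_filter, mem_genCx]
  constructor
  · rintro ⟨⟨-, τ, hτ, hστ⟩, hσ⟩
    rwa [Finset.eq_of_subset_of_card_le hστ (by rw [hσ, hF τ hτ])]
  · intro hσ
    exact ⟨⟨Finset.card_pos.1 (by rw [hF σ hσ]; omega), σ, hσ, subset_rfl⟩, hF σ hσ⟩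

lemma verts_stdSphere {B : Finset α} (hB : 2 ≤ B.card) : verts (stdSphere B) = B := by
  refine (Finset.sup_le fun σ hσ => ?_).antisymm fun x hx => ?_
  · exact Finset.mem_powerset.1 (Finset.mem_filter.1 hσ).1
  · have hmem : {x} ∈ stdSphere B := by
      simp only [stdSphere, Finset.mem_filter, Finset.mem_powerset,
        Finset.singleton_subset_iff, Finset.singleton_nonempty, true_and]
      refine ⟨hx, ?_⟩
      rintro rfl
      simp at hB
    exact subset_verts hmem (Finset.mem_singleton_self x)

/-- The members of `F` that contain `A`, united, with `A` removed. -/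
def starVerts (F : Finset (Finset α)) (A : Finset α) : Finset α :=
  (F.filter fun τ => A ⊆ τ).sup id \ A

lemma verts_link_genCx (F : Finset (Finset α)) (A : Finset α) :
    verts (link (genCx F) A) = starVerts F A := by
  ext x
  simp only [mem_verts, link, starVerts, Finset.mem_filter, mem_genCx, Finset.mem_sdiff,
    Finset.mem_sup, id]
  constructor
  · rintro ⟨σ, ⟨-, hd, -, τ, hτ, hστ⟩, hx⟩
    exact ⟨⟨τ, ⟨hτ, Finset.subset_union_left.trans hστ⟩, hστ (Finset.mem_union_right _ hx)⟩,
      Finset.disjoint_left.1 hd hx⟩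
  · rintro ⟨⟨τ, ⟨hτ, hA⟩, hx⟩, hxA⟩
    have hxτ : {x} ⊆ τ := Finset.singleton_subset_iff.2 hx
    exact ⟨{x}, ⟨⟨Finset.singleton_nonempty x, τ, hτ, hxτ⟩,
      Finset.disjoint_singleton_left.2 hxA,
      (Finset.singleton_nonempty x).mono Finset.subset_union_right, τ, hτ,
      Finset.union_subset hA hxτ⟩, Finset.mem_singleton_self x⟩

/-- The family of finite sets given by a list of lists. -/
def toFamily (L : List (List α)) : Finset (Finset α) := (L.map List.toFinset).toFinset

lemma mem_toFamily {L : List (List α)} {σ : Finset α} :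
    σ ∈ toFamily L ↔ ∃ l ∈ L, l.toFinset = σ := by
  simp [toFamily]

lemma toFinset_subset_toFinset {l m : List α} : l.toFinset ⊆ m.toFinset ↔ l ⊆ m := by
  simp only [Finset.subset_iff, List.mem_toFinset]
  rfl

/-- `L` lists, without repetition, sets with four elements. -/
def IsFacetList (L : List (List α)) : Prop :=
  (∀ l ∈ L, l.Nodup ∧ l.length = 4) ∧ L.Pairwise fun l m => ¬ l ⊆ m

instance (L : List (List α)) : Decidable (IsFacetList L) :=
  inferInstanceAs (Decidable (_ ∧ _))

/-- The vertices outside `A` of the members of `L` that contain `A`. -/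
def starList (L : List (List α)) (A : List α) : List α :=
  ((L.filter fun l => A ⊆ l).flatten.filter fun x => x ∉ A).dedup

/-- A condition on the facets of a pure 3-dimensional complex under which no edge or triangle
is removable. -/
def Rigid (L : List (List α)) : Prop :=
  ∀ l ∈ L, ∀ A ∈ l.sublists, 2 ≤ A.length →
    (starList L A).length + A.length = 5 → ∃ m ∈ L, starList L A ⊆ m

instance (L : List (List α)) : Decidable (Rigid L) :=
  inferInstanceAs (Decidable (∀ l ∈ L, ∀ A ∈ l.sublists, _ → _ → _))

/-- `interCubeSum` computed on lists. -/
def listInterCubeSum (L : List (List α)) : ℕ :=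
  (L.map fun l => (L.map fun m => (l.filter fun x => x ∈ m).length ^ 3).sum).sum

lemma IsFacetList.card_eq {L : List (List α)} (hL : IsFacetList L) {σ : Finset α}
    (hσ : σ ∈ toFamily L) : σ.card = 4 := by
  obtain ⟨l, hl, rfl⟩ := mem_toFamily.1 hσ
  rw [List.toFinset_card_of_nodup (hL.1 l hl).1, (hL.1 l hl).2]

lemma IsFacetList.interCubeSum_eq {L : List (List α)} (hL : IsFacetList L) :
    interCubeSum (toFamily L) = listInterCubeSum L := by
  have hnd : (L.map List.toFinset).Nodup := by
    rw [List.Nodup, List.pairwise_map]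
    refine hL.2.imp fun {l m} h he => h fun x hx => ?_
    exact List.mem_toFinset.1 (he ▸ List.mem_toFinset.2 hx)
  have hsum (g : Finset α → ℕ) :
      ∑ σ ∈ toFamily L, g σ = (L.map fun l => g l.toFinset).sum := by
    rw [toFamily, List.sum_toFinset _ hnd, List.map_map]
    rfl
  unfold interCubeSum listInterCubeSum
  rw [hsum]
  refine congrArg List.sum (List.map_congr_left fun l hl => ?_)
  rw [hsum]
  refine congrArg List.sum (List.map_congr_left fun m _ => ?_)
  rw [← List.toFinset_card_of_nodup ((hL.1 l hl).1.filter _)]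
  congr 2
  ext x
  simp

lemma toFinset_starList (L : List (List α)) (A : List α) :
    (starList L A).toFinset = starVerts (toFamily L) A.toFinset := by
  ext x
  simp only [starList, starVerts, List.mem_toFinset, List.mem_dedup, List.mem_filter,
    List.mem_flatten, decide_eq_true_eq, Finset.mem_sdiff, Finset.mem_sup, Finset.mem_filter,
    mem_toFamily, id]
  refine and_congr_left' ⟨?_, ?_⟩
  · rintro ⟨l, ⟨hl, hA⟩, hx⟩
    exact ⟨l.toFinset, ⟨⟨l, hl, rfl⟩, toFinset_subset_toFinset.2 hA⟩,
      List.mem_toFinset.2 hx⟩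
  · rintro ⟨_, ⟨⟨l, hl, rfl⟩, hA⟩, hx⟩
    exact ⟨l, ⟨hl, toFinset_subset_toFinset.1 hA⟩,
      List.mem_toFinset.1 hx⟩

lemma Rigid.not_pMove {L : List (List α)} {K : Complex α} (hL : IsFacetList L) (hR : Rigid L) :
    ¬ PMove 3 (genCx (toFamily L)) K := by
  rintro ⟨i, hi, hi3, A, B, hA, hAc, hBc, hBK, hlink, -⟩
  obtain ⟨-, τ, hτ, hAτ⟩ := mem_genCx.1 hA
  obtain ⟨l, hl, rfl⟩ := mem_toFamily.1 hτ
  set A' := l.filter fun x => x ∈ A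
  have hA' : A'.toFinset = A := by
    ext x
    simpa [A'] using fun hx => List.mem_toFinset.1 (hAτ hx)
  have hv : (starList L A').toFinset = B := by
    rw [toFinset_starList, hA', ← verts_link_genCx, hlink, verts_stdSphere (by omega)]
  have hlenA : A'.length = A.card := by
    rw [← hA', List.toFinset_card_of_nodup ((hL.1 l hl).1.filter _)]
  have hlenB : (starList L A').length = B.card := by
    rw [← hv, List.toFinset_card_of_nodup (l := starList L A') (List.nodup_dedup _)]
  obtain ⟨m, hm, hBm⟩ := hR l hl A' (List.mem_sublists.2 List.filter_sublist) (by omega) (by omega)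
  exact hBK (mem_genCx.2 ⟨Finset.card_pos.1 (by omega), m.toFinset,
    mem_toFamily.2 ⟨m, hm, rfl⟩, hv ▸ toFinset_subset_toFinset.2 hBm⟩)

/-- `K` is generated by four-element facets with invariant `n`. -/
def HasInvariant (K : Complex α) (n : ℕ) : Prop :=
  ∃ L : List (List α), K = genCx (toFamily L) ∧ IsFacetList L ∧ listInterCubeSum L = n

lemma HasInvariant.interCubeSum_facets {K : Complex α} {n : ℕ} (h : HasInvariant K n) :
    interCubeSum (facets K 3) = n := by
  obtain ⟨L, rfl, hL, rfl⟩ := h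
  rw [facets_genCx fun σ hσ => hL.card_eq hσ, hL.interCubeSum_eq]

lemma not_iso_of_pEquiv {K : Complex α} {M : Complex β} {k m : ℕ}
    (hK : ∀ K', ¬ PMove 3 K K') (hk : HasInvariant K k) (hm : HasInvariant M m) (hkm : k ≠ m)
    (K' : Complex α) (h : PEquiv 3 K K') : ¬ Iso K' M := by
  intro hi
  obtain rfl | ⟨_, hmove, -⟩ := h.cases_head
  · rw [← hk.interCubeSum_facets, ← hm.interCubeSum_facets] at hkm
    exact hkm (interCubeSum_facets_eq_of_iso 3 hi)
  · exact hK _ hmove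

end

end NPM

/-- The facets of `N1`. -/
def facetList1 : List (List ℕ) :=
  [[1, 2, 4, 8], [1, 2, 6, 8], [1, 3, 4, 8], [1, 3, 7, 8], [1, 5, 6, 8], [1, 5, 7, 8],
   [2, 3, 5, 8], [2, 3, 7, 8], [2, 4, 5, 8], [2, 6, 7, 8], [3, 4, 6, 8], [3, 5, 6, 8],
   [4, 5, 7, 8], [4, 6, 7, 8], [1, 2, 4, 7], [1, 2, 5, 7], [1, 3, 6, 7], [1, 4, 6, 7],
   [2, 3, 4, 7], [2, 5, 6, 7], [3, 4, 5, 7], [3, 5, 6, 7], [1, 2, 3, 6], [2, 3, 4, 6],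
   [1, 3, 4, 5], [1, 2, 3, 5], [1, 4, 5, 6], [2, 4, 5, 6]]

lemma N1_eq : N1 = NPM.genCx (NPM.toFamily facetList1) := by
  simp [N1, NPM.toFamily, facetList1]

lemma hasInvariant_N1 : NPM.HasInvariant N1 8960 :=
  ⟨_, N1_eq, by decide +kernel, by decide +kernel⟩

lemma not_pMove_N1 (K : NPM.Complex ℕ) : ¬ NPM.PMove 3 N1 K :=
  N1_eq ▸ NPM.Rigid.not_pMove (L := facetList1) (by decide +kernel) (by decide +kernel)

/-- The facets of `N2`. -/
def facetList2 : List (List ℕ) :=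
  [[1, 2, 4, 8], [2, 4, 5, 8], [2, 3, 5, 8], [3, 5, 6, 8], [3, 4, 6, 8], [4, 6, 7, 8],
   [4, 5, 7, 8], [1, 5, 7, 8], [1, 5, 6, 8], [1, 2, 6, 8], [2, 6, 7, 8], [2, 3, 7, 8],
   [1, 3, 7, 8], [1, 3, 4, 8], [1, 2, 4, 7], [2, 4, 5, 7], [2, 3, 5, 7], [3, 5, 6, 7],
   [3, 4, 6, 7], [1, 5, 6, 7], [1, 2, 6, 7], [1, 3, 4, 7]]

lemma N2_eq : N2 = NPM.genCx (NPM.toFamily facetList2) := by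
  simp [N2, NPM.toFamily, facetList2]

lemma hasInvariant_N2 : NPM.HasInvariant N2 6044 :=
  ⟨_, N2_eq, by decide +kernel, by decide +kernel⟩

lemma not_pMove_N2 (K : NPM.Complex ℕ) : ¬ NPM.PMove 3 N2 K :=
  N2_eq ▸ NPM.Rigid.not_pMove (L := facetList2) (by decide +kernel) (by decide +kernel)

/-- The facets of `N3`. -/
def facetList3 : List (List ℕ) :=
  [[1, 2, 4, 8], [1, 2, 6, 8], [1, 3, 4, 8], [1, 3, 7, 8], [1, 5, 6, 8], [1, 5, 7, 8],
   [2, 3, 5, 8], [2, 3, 7, 8], [2, 4, 5, 8], [2, 6, 7, 8], [3, 4, 6, 8], [3, 5, 6, 8],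
   [4, 5, 7, 8], [4, 6, 7, 8], [1, 2, 3, 4], [2, 3, 4, 7], [2, 4, 5, 6], [2, 4, 6, 7],
   [3, 4, 5, 6], [3, 4, 5, 7], [1, 2, 3, 5], [1, 2, 5, 6], [1, 3, 5, 7]]

lemma N3_eq : N3 = NPM.genCx (NPM.toFamily facetList3) := by
  simp [N3, NPM.toFamily, facetList3]

lemma hasInvariant_N3 : NPM.HasInvariant N3 6448 :=
  ⟨_, N3_eq, by decide +kernel, by decide +kernel⟩

lemma not_pMove_N3 (K : NPM.Complex ℕ) : ¬ NPM.PMove 3 N3 K :=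
  N3_eq ▸ NPM.Rigid.not_pMove (L := facetList3) (by decide +kernel) (by decide +kernel)

/-- The facets of `N4`. -/
def facetList4 : List (List ℕ) :=
  [[1, 2, 4, 8], [1, 2, 6, 8], [1, 3, 4, 8], [1, 3, 7, 8], [1, 5, 6, 8], [1, 5, 7, 8],
   [2, 3, 5, 8], [2, 3, 7, 8], [2, 4, 5, 8], [2, 6, 7, 8], [3, 4, 6, 8], [3, 5, 6, 8],
   [4, 5, 7, 8], [4, 6, 7, 8], [1, 2, 4, 5], [1, 2, 5, 6], [2, 3, 5, 6], [2, 3, 6, 7],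
   [3, 4, 6, 7], [1, 3, 4, 7], [1, 4, 5, 7]]

lemma N4_eq : N4 = NPM.genCx (NPM.toFamily facetList4) := by
  simp [N4, NPM.toFamily, facetList4]

lemma hasInvariant_N4 : NPM.HasInvariant N4 5516 :=
  ⟨_, N4_eq, by decide +kernel, by decide +kernel⟩

lemma not_pMove_N4 (K : NPM.Complex ℕ) : ¬ NPM.PMove 3 N4 K :=
  N4_eq ▸ NPM.Rigid.not_pMove (L := facetList4) (by decide +kernel) (by decide +kernel)

/-- The facets of `N5`. -/
def facetList5 : List (List ℕ) :=
  [[1, 2, 5, 8], [1, 2, 6, 8], [1, 3, 5, 8], [1, 3, 7, 8], [1, 4, 6, 8], [1, 4, 7, 8],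
   [2, 3, 6, 8], [2, 3, 7, 8], [2, 4, 5, 8], [2, 4, 7, 8], [3, 4, 5, 8], [3, 4, 6, 8],
   [1, 2, 5, 7], [1, 2, 6, 7], [1, 3, 6, 7], [1, 4, 5, 7], [2, 3, 5, 7], [2, 4, 6, 7],
   [3, 4, 5, 7], [3, 4, 6, 7], [2, 3, 5, 6], [2, 4, 5, 6], [1, 3, 5, 6], [1, 4, 5, 6]]

lemma N5_eq : N5 = NPM.genCx (NPM.toFamily facetList5) := by
  simp [N5, NPM.toFamily, facetList5]

lemma hasInvariant_N5 : NPM.HasInvariant N5 6912 :=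
  ⟨_, N5_eq, by decide +kernel, by decide +kernel⟩

lemma not_pMove_N5 (K : NPM.Complex ℕ) : ¬ NPM.PMove 3 N5 K :=
  N5_eq ▸ NPM.Rigid.not_pMove (L := facetList5) (by decide +kernel) (by decide +kernel)

/-- The facets of `N6`. -/
def facetList6 : List (List ℕ) :=
  [[1, 3, 5, 8], [1, 3, 7, 8], [1, 4, 6, 8], [1, 4, 7, 8], [1, 5, 6, 8], [2, 3, 6, 8],
   [2, 3, 7, 8], [2, 4, 5, 8], [2, 4, 7, 8], [2, 5, 6, 8], [3, 4, 5, 8], [3, 4, 6, 8],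
   [1, 2, 3, 5], [1, 2, 4, 5], [1, 4, 5, 7], [1, 5, 6, 7], [2, 3, 5, 7], [2, 5, 6, 7],
   [3, 4, 5, 7], [1, 2, 3, 6], [1, 2, 4, 6], [1, 3, 6, 7], [2, 4, 6, 7], [3, 4, 6, 7]]

lemma N6_eq : N6 = NPM.genCx (NPM.toFamily facetList6) := by
  simp [N6, NPM.toFamily, facetList6]

lemma hasInvariant_N6 : NPM.HasInvariant N6 6816 :=
  ⟨_, N6_eq, by decide +kernel, by decide +kernel⟩

lemma not_pMove_N6 (K : NPM.Complex ℕ) : ¬ NPM.PMove 3 N6 K :=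
  N6_eq ▸ NPM.Rigid.not_pMove (L := facetList6) (by decide +kernel) (by decide +kernel)

/-- The facets of `N7`. -/
def facetList7 : List (List ℕ) :=
  [[1, 2, 6, 8], [1, 2, 5, 8], [1, 3, 5, 8], [1, 3, 7, 8], [1, 4, 7, 8], [1, 4, 6, 8],
   [2, 3, 7, 8], [2, 3, 6, 8], [2, 4, 5, 8], [2, 4, 7, 8], [3, 4, 6, 8], [3, 4, 5, 8],
   [1, 3, 5, 6], [1, 3, 6, 7], [2, 3, 5, 7], [2, 3, 5, 6], [3, 4, 6, 7], [3, 4, 5, 7],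
   [1, 2, 5, 6], [1, 4, 6, 7], [2, 4, 5, 7]]

lemma N7_eq : N7 = NPM.genCx (NPM.toFamily facetList7) := by
  simp [N7, NPM.toFamily, facetList7]

lemma hasInvariant_N7 : NPM.HasInvariant N7 5532 :=
  ⟨_, N7_eq, by decide +kernel, by decide +kernel⟩

/-- for `1 ≤ i < j ≤ 7`, `N_j` cannot be obtained from `N_i` by a
finite sequence of proper bistellar moves, even up to isomorphism. -/
theorem statement9 :
    ([N1, N2, N3, N4, N5, N6, N7] : List (NPM.Complex ℕ)).Pairwise
      (fun X Y => ∀ L : NPM.Complex ℕ, NPM.PEquiv 3 X L → ¬ NPM.Iso L Y) := by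
  simp only [List.pairwise_cons, List.forall_mem_cons, List.Pairwise.nil, and_true,
    List.not_mem_nil, false_imp_iff, implies_true]
  refine ⟨⟨NPM.not_iso_of_pEquiv not_pMove_N1 hasInvariant_N1 hasInvariant_N2 (by decide),
      NPM.not_iso_of_pEquiv not_pMove_N1 hasInvariant_N1 hasInvariant_N3 (by decide),
      NPM.not_iso_of_pEquiv not_pMove_N1 hasInvariant_N1 hasInvariant_N4 (by decide),
      NPM.not_iso_of_pEquiv not_pMove_N1 hasInvariant_N1 hasInvariant_N5 (by decide),
      NPM.not_iso_of_pEquiv not_pMove_N1 hasInvariant_N1 hasInvariant_N6 (by decide),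
      NPM.not_iso_of_pEquiv not_pMove_N1 hasInvariant_N1 hasInvariant_N7 (by decide)⟩,
    ⟨NPM.not_iso_of_pEquiv not_pMove_N2 hasInvariant_N2 hasInvariant_N3 (by decide),
      NPM.not_iso_of_pEquiv not_pMove_N2 hasInvariant_N2 hasInvariant_N4 (by decide),
      NPM.not_iso_of_pEquiv not_pMove_N2 hasInvariant_N2 hasInvariant_N5 (by decide),
      NPM.not_iso_of_pEquiv not_pMove_N2 hasInvariant_N2 hasInvariant_N6 (by decide),
      NPM.not_iso_of_pEquiv not_pMove_N2 hasInvariant_N2 hasInvariant_N7 (by decide)⟩,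
    ⟨NPM.not_iso_of_pEquiv not_pMove_N3 hasInvariant_N3 hasInvariant_N4 (by decide),
      NPM.not_iso_of_pEquiv not_pMove_N3 hasInvariant_N3 hasInvariant_N5 (by decide),
      NPM.not_iso_of_pEquiv not_pMove_N3 hasInvariant_N3 hasInvariant_N6 (by decide),
      NPM.not_iso_of_pEquiv not_pMove_N3 hasInvariant_N3 hasInvariant_N7 (by decide)⟩,
    ⟨NPM.not_iso_of_pEquiv not_pMove_N4 hasInvariant_N4 hasInvariant_N5 (by decide),
      NPM.not_iso_of_pEquiv not_pMove_N4 hasInvariant_N4 hasInvariant_N6 (by decide),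
      NPM.not_iso_of_pEquiv not_pMove_N4 hasInvariant_N4 hasInvariant_N7 (by decide)⟩,
    ⟨NPM.not_iso_of_pEquiv not_pMove_N5 hasInvariant_N5 hasInvariant_N6 (by decide),
      NPM.not_iso_of_pEquiv not_pMove_N5 hasInvariant_N5 hasInvariant_N7 (by decide)⟩,
    NPM.not_iso_of_pEquiv not_pMove_N6 hasInvariant_N6 hasInvariant_N7 (by decide)⟩
end

section
/- Let K be a neighbourly normal 3-pseudomanifold with exactly 8 vertices. If some vertex of K has its link isomorphic to the 7-vertex torus T, then K is isomorphic to N_1, N_2, N_3 or N_4. -/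
/-- The 7-vertex torus `T`. -/
def T7 : NPM.Complex ℕ :=
  NPM.genCx {{1,2,4}, {1,2,6}, {1,3,4}, {1,3,7}, {1,5,6}, {1,5,7}, {2,3,5}, {2,3,7}, {2,4,5}, {2,6,7}, {3,4,6}, {3,5,6}, {4,5,7}, {4,6,7}}

namespace TorusLink

open Finset

section Search

/-- A cardinality constraint: the number of members of the list which are selected is one of the
listed values. -/
abbrev Constraint := List ℕ × List ℕ

/-- The selection `S` satisfies the constraint `c`. -/
def Satisfies (S : ℕ → Bool) (c : Constraint) : Prop := c.1.countP S ∈ c.2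

/-- Can the constraint still be satisfied once the bits of `y` are selected and those of `n` are
discarded? -/
def feasible (c : Constraint) (y n : ℕ) : Bool :=
  c.2.any fun k => Nat.ble (c.1.countP y.testBit) k &&
    Nat.ble (k + c.1.countP n.testBit) c.1.length

/-- Backtracking search through all selections on a list of numbers, pruning by the constraints
in `near q` when `q` is decided. -/
def search (near : ℕ → List Constraint) (final : ℕ → Bool) : List ℕ → ℕ → ℕ → Bool
  | [], y, _ => final y
  | q :: qs, y, n =>
    (!((near q).all fun c => feasible c (y ||| 2 ^ q) n) ||
        search near final qs (y ||| 2 ^ q) n) &&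
      (!((near q).all fun c => feasible c y (n ||| 2 ^ q)) ||
        search near final qs y (n ||| 2 ^ q))

theorem feasible_of_satisfies {S : ℕ → Bool} {c : Constraint} {y n : ℕ} (hc : Satisfies S c)
    (hy : ∀ i, y.testBit i = true → S i = true) (hn : ∀ i, n.testBit i = true → S i = false) :
    feasible c y n = true := by
  simp only [feasible, List.any_eq_true, Bool.and_eq_true, Nat.ble_eq]
  refine ⟨_, hc, List.countP_mono_left fun i _ => hy i, ?_⟩
  rw [List.length_eq_countP_add_countP (p := S) (l := c.1)]
  gcongr
  exact List.countP_mono_left fun i _ hi => by simp [hn i hi]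

theorem exists_final_of_search {near : ℕ → List Constraint} {final : ℕ → Bool} {S : ℕ → Bool} :
    ∀ (qs : List ℕ) (y n : ℕ), (∀ q ∈ qs, ∀ c ∈ near q, Satisfies S c) →
      (∀ i, y.testBit i = true → S i = true) → (∀ i, n.testBit i = true → S i = false) →
      search near final qs y n = true →
      ∃ z, final z = true ∧ (∀ i, z.testBit i = true → S i = true) ∧
        (∀ i, y.testBit i = true → z.testBit i = true) ∧ ∀ q ∈ qs, z.testBit q = S q := by
  intro qs
  induction qs with
  | nil => intro y n _ hy _ h; exact ⟨y, h, hy, fun _ => id, by simp⟩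
  | cons q qs ih =>
    intro y n hc hy hn h
    simp only [search, Bool.and_eq_true, Bool.or_eq_true, Bool.not_eq_true'] at h
    have hc' : ∀ r ∈ qs, ∀ c ∈ near r, Satisfies S c :=
      fun r hr => hc r (List.mem_cons_of_mem _ hr)
    cases hS : S q with
    | true =>
      have hy' : ∀ i, (y ||| 2 ^ q).testBit i = true → S i = true := by
        intro i hi
        rw [Nat.testBit_or, Nat.testBit_two_pow, Bool.or_eq_true, decide_eq_true_eq] at hi
        rcases hi with hi | rfl
        exacts [hy i hi, hS]
      obtain ⟨z, h1, h2, h3, h4⟩ := ih _ _ hc' hy' hn (h.1.resolve_left (by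
        rw [Bool.not_eq_false, List.all_eq_true]
        exact fun c hcq => feasible_of_satisfies (hc q (by simp) c hcq) hy' hn))
      refine ⟨z, h1, h2, fun i hi => h3 i (by simp [hi]), ?_⟩
      intro r hr
      rcases List.mem_cons.1 hr with rfl | hr
      · rw [hS]; exact h3 r (by simp)
      · exact h4 r hr
    | false =>
      have hn' : ∀ i, (n ||| 2 ^ q).testBit i = true → S i = false := by
        intro i hi
        rw [Nat.testBit_or, Nat.testBit_two_pow, Bool.or_eq_true, decide_eq_true_eq] at hi
        rcases hi with hi | rfl
        exacts [hn i hi, hS]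
      obtain ⟨z, h1, h2, h3, h4⟩ := ih _ _ hc' hy hn' (h.2.resolve_left (by
        rw [Bool.not_eq_false, List.all_eq_true]
        exact fun c hcq => feasible_of_satisfies (hc q (by simp) c hcq) hy hn'))
      refine ⟨z, h1, h2, h3, ?_⟩
      intro r hr
      rcases List.mem_cons.1 hr with rfl | hr
      · by_contra hne
        have := h2 r (by simpa [hS] using hne)
        simp [hS] at this
      · exact h4 r hr

end Search

section Masks

/-- The elements of `{1, …, 7}` whose bit in `m` is set. -/
def bitsIn (m : ℕ) : List ℕ := [1, 2, 3, 4, 5, 6, 7].filter m.testBit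

/-- The elements of `{1, …, 7}` whose bit in `m` is not set. -/
def bitsOut (m : ℕ) : List ℕ := [1, 2, 3, 4, 5, 6, 7].filter fun x => !m.testBit x

/-- The subset of `{1, …, 7}` with characteristic bit mask `m`. -/
def face (m : ℕ) : Finset ℕ := (bitsIn m).toFinset

/-- The masks of the four-element subsets of `{1, …, 7}`. -/
def quads : List ℕ :=
  [30, 46, 78, 142, 54, 86, 150, 102, 166, 198, 58, 90, 154, 106, 170, 202, 114, 178, 210, 226, 60,
    92, 156, 108, 172, 204, 116, 180, 212, 228, 120, 184, 216, 232, 240]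

/-- The masks of the facets of the torus. -/
def torus : List ℕ := [22, 70, 26, 138, 98, 162, 44, 140, 52, 196, 88, 104, 176, 208]

/-- For each of the four complexes `N1`, `N2`, `N3`, `N4`, the masks of its facets avoiding `8`. -/
def models : List (List ℕ) :=
  [[46, 58, 78, 92, 114, 116, 150, 156, 166, 184, 202, 210, 228, 232],
    [150, 154, 172, 180, 198, 216, 226, 232],
    [30, 46, 102, 116, 120, 156, 170, 184, 212],
    [54, 102, 108, 154, 178, 204, 216]]

/-- The affine map `x ↦ a * x + b` on residues modulo `7`, represented by `1, …, 7`, and fixing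
`8`. -/
def affine (p : ℕ × ℕ) (x : ℕ) : ℕ := if x = 8 then 8 else (p.1 * x + p.2 + 6) % 7 + 1

/-- Affine maps preserving the torus. -/
def affineParams : List (ℕ × ℕ) :=
  [1, 2, 4].flatMap fun a => [0, 1, 2, 3, 4, 5, 6].map fun b => (a, b)

/-- The mask of the image of a mask under an affine map. -/
def affineMask (p : ℕ × ℕ) (m : ℕ) : ℕ := ((bitsIn m).map fun x => 2 ^ affine p x).sum

/-- A triple of the torus lies in one facet avoiding `8`, any other triple in none or two. -/
def tripleConstraint (t : ℕ) : Constraint :=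
  ((bitsOut t).map fun x => t + 2 ^ x, if torus.contains t then [1] else [0, 2])

/-- At most two facets lie inside a given set of five vertices. -/
def pentConstraint (p : ℕ) : Constraint := ((bitsIn p).map fun x => p - 2 ^ x, [0, 1, 2])

/-- The constraints involving a given quadruple. -/
def near (q : ℕ) : List Constraint :=
  ((bitsIn q).map fun x => tripleConstraint (q - 2 ^ x)) ++
    (bitsOut q).map fun x => pentConstraint (q + 2 ^ x)

/-- Does the selection given by the bits of `y` agree with one of the models up to an affine
map? -/
def isModel (y : ℕ) : Bool :=
  affineParams.any fun p => models.any fun G =>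
    quads.all fun q => y.testBit q == G.contains (affineMask p q)

theorem search_near_isModel : search near isModel quads 0 0 = true := by
  decide +kernel

theorem exists_model {S : ℕ → Bool} (hS : ∀ q ∈ quads, ∀ c ∈ near q, Satisfies S c) :
    ∃ p ∈ affineParams, ∃ G ∈ models, ∀ q ∈ quads, (S q = true ↔ affineMask p q ∈ G) := by
  obtain ⟨z, h1, -, -, h2⟩ :=
    exists_final_of_search quads 0 0 hS (by simp) (by simp) search_near_isModel
  simp only [isModel, List.any_eq_true, List.all_eq_true] at h1
  obtain ⟨p, hp, G, hG, h⟩ := h1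
  refine ⟨p, hp, G, hG, fun q hq => ?_⟩
  have := h q hq
  rw [h2 q hq, beq_iff_eq] at this
  rw [this, List.contains_iff_mem]

theorem face_subset (m : ℕ) : face m ⊆ Icc 1 7 := by
  intro x hx
  simp only [face, bitsIn, List.mem_toFinset, List.mem_filter, List.mem_cons] at hx
  simp only [Finset.mem_Icc]
  grind

theorem exists_quad : ∀ s ∈ powersetCard 4 (Icc 1 7), ∃ q ∈ quads, face q = s := by
  decide +kernel

theorem card_face_quad : ∀ q ∈ quads, (face q).card = 4 := by
  decide +kernel

theorem card_face_torus : ∀ m ∈ torus, (face m).card = 3 := by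
  decide +kernel

theorem image_affine_quad : ∀ p ∈ affineParams, ∀ q ∈ quads,
    (face q).image (affine p) = face (affineMask p q) := by
  decide +kernel

theorem image_affine_torus : ∀ p ∈ affineParams, ∀ m ∈ torus,
    (face m).image (affine p) = face (affineMask p m) ∧ affineMask p m ∈ torus := by
  decide +kernel

theorem exists_affineMask_torus : ∀ p ∈ affineParams, ∀ m ∈ torus,
    ∃ m' ∈ torus, affineMask p m' = m := by
  decide +kernel

theorem exists_affineMask_quad : ∀ p ∈ affineParams, ∀ G ∈ models, ∀ m ∈ G,
    ∃ q ∈ quads, affineMask p q = m := by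
  decide +kernel

theorem affine_mem : ∀ p ∈ affineParams, ∀ x ∈ Icc 1 8, ∀ y ∈ Icc 1 8,
    affine p x = affine p y → x = y := by
  decide +kernel

theorem triple_data : ∀ q ∈ quads, ∀ x ∈ bitsIn q,
    (face (q - 2 ^ x)).card = 3 ∧
      (∀ m ∈ torus, face m = face (q - 2 ^ x) → m = q - 2 ^ x) ∧
      ∀ y ∈ bitsOut (q - 2 ^ x), face (q - 2 ^ x + 2 ^ y) = insert y (face (q - 2 ^ x)) := by
  decide +kernel

theorem pent_data : ∀ q ∈ quads, ∀ x ∈ bitsOut q,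
    (face (q + 2 ^ x)).card = 5 ∧
      ∀ y ∈ bitsIn (q + 2 ^ x), face (q + 2 ^ x - 2 ^ y) = (face (q + 2 ^ x)).erase y := by
  decide +kernel

/-- The facets of the complex described by a list of masks of facets avoiding `8`. -/
def modelFacets (G : List ℕ) : Finset (Finset ℕ) :=
  (torus.map fun m => insert 8 (face m)).toFinset ∪ (G.map face).toFinset

theorem T7_eq : T7 = NPM.genCx (torus.map face).toFinset :=
  congrArg NPM.genCx (by decide +kernel)

theorem N1_eq : N1 = NPM.genCx (modelFacets (models[0])) :=
  congrArg NPM.genCx (by decide +kernel)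

theorem N2_eq : N2 = NPM.genCx (modelFacets (models[1])) :=
  congrArg NPM.genCx (by decide +kernel)

theorem N3_eq : N3 = NPM.genCx (modelFacets (models[2])) :=
  congrArg NPM.genCx (by decide +kernel)

theorem N4_eq : N4 = NPM.genCx (modelFacets (models[3])) :=
  congrArg NPM.genCx (by decide +kernel)

end Masks

section Complexes

open NPM

variable {α : Type*} [DecidableEq α] {K : Complex α}

theorem mem_verts {x : α} : x ∈ verts K ↔ ∃ σ ∈ K, x ∈ σ := by
  simp [verts, Finset.mem_sup]

theorem subset_verts {σ : Finset α} (hσ : σ ∈ K) : σ ⊆ verts K :=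
  fun _ hx => mem_verts.2 ⟨σ, hσ, hx⟩

theorem mem_genCx {F : Finset (Finset α)} {s : Finset α} :
    s ∈ genCx F ↔ s.Nonempty ∧ ∃ σ ∈ F, s ⊆ σ := by
  simp only [genCx, mem_biUnion, mem_filter, mem_powerset]
  tauto

theorem genCx_image {β : Type*} [DecidableEq β] (F : Finset (Finset α)) (f : α → β) :
    genCx (F.image (image f)) = (genCx F).image (image f) := by
  ext s
  simp only [mem_genCx, mem_image]
  constructor
  · rintro ⟨hs, _, ⟨σ, hσ, rfl⟩, hsσ⟩
    obtain ⟨t, ht, rfl⟩ := subset_image_iff.1 hsσ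
    exact ⟨t, ⟨image_nonempty.1 hs, σ, hσ, ht⟩, rfl⟩
  · rintro ⟨t, ⟨ht, σ, hσ, h⟩, rfl⟩
    exact ⟨ht.image f, _, ⟨σ, hσ, rfl⟩, image_subset_image h⟩

theorem eq_genCx_facets {d : ℕ} (hK : IsComplex K) (hp : IsPure K d) :
    K = genCx (facets K d) := by
  ext s
  simp only [mem_genCx, facets, mem_filter]
  constructor
  · intro hs
    obtain ⟨τ, hτ, h1, h2⟩ := hp s hs
    exact ⟨hK.2.1 s hs, τ, ⟨hτ, h2⟩, h1⟩
  · rintro ⟨hs, σ, ⟨hσ, -⟩, h⟩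
    exact hK.2.2 σ hσ s h hs

theorem card_cofaces (hK : WeakPM K 3) {t : Finset α} (ht : t.card = 3) :
    ((verts K \ t).filter fun x => insert x t ∈ K).card = 0 ∨
      ((verts K \ t).filter fun x => insert x t ∈ K).card = 2 := by
  by_cases h : t ∈ K
  · right
    rw [← hK.2.2 t h ht]
    refine card_bij (fun x _ => insert x t) ?_ ?_ ?_
    · intro x hx
      simp only [mem_filter, mem_sdiff] at hx ⊢
      exact ⟨hx.2, subset_insert _ _, by rw [card_insert_of_notMem hx.1.2, ht]⟩
    · intro x hx y hy hxy
      simp only [mem_filter, mem_sdiff] at hx hy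
      have : x ∈ insert y t := by simp [← hxy]
      exact (mem_insert.1 this).resolve_right hx.1.2
    · intro τ hτ
      simp only [mem_filter] at hτ
      obtain ⟨h1, h2, h3⟩ := hτ
      have hc : (τ \ t).card = 1 := by rw [card_sdiff_of_subset h2]; omega
      obtain ⟨x, hx⟩ := card_eq_one.1 hc
      have hxm : x ∈ τ \ t := by simp [hx]
      have hτx : insert x t = τ := by
        rw [insert_eq, ← hx, sdiff_union_of_subset h2]
      refine ⟨x, ?_, hτx⟩
      simp only [mem_filter, mem_sdiff, hτx]
      exact ⟨⟨subset_verts h1 (mem_sdiff.1 hxm).1, (mem_sdiff.1 hxm).2⟩, h1⟩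
  · left
    rw [card_eq_zero, filter_eq_empty_iff]
    intro x _ hx
    exact h (hK.1.2.2 _ hx t (subset_insert _ _) (card_pos.1 (by omega)))

theorem eq_or_eq_of_coface (hK : WeakPM K 3) {t : Finset α} (ht : t.card = 3) {x y z : α}
    (hx : x ∉ t) (hy : y ∉ t) (hz : z ∉ t) (hxy : x ≠ y) (hxK : insert x t ∈ K)
    (hyK : insert y t ∈ K) (hzK : insert z t ∈ K) : z = x ∨ z = y := by
  by_contra! hne
  have hs : ({x, y, z} : Finset α) ⊆ (verts K \ t).filter fun x => insert x t ∈ K := by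
    intro w hw
    simp only [mem_insert, mem_singleton] at hw
    simp only [mem_filter, mem_sdiff]
    rcases hw with rfl | rfl | rfl
    exacts [⟨⟨subset_verts hxK (by simp), hx⟩, hxK⟩, ⟨⟨subset_verts hyK (by simp), hy⟩, hyK⟩,
      ⟨⟨subset_verts hzK (by simp), hz⟩, hzK⟩]
  have h3 : ({x, y, z} : Finset α).card = 3 :=
    card_eq_three.2 ⟨x, y, z, hxy, hne.1.symm, hne.2.symm, rfl⟩
  have := card_le_card hs
  rcases card_cofaces hK ht with h | h <;> omega

/-- A triangle in the link of an edge of a normal 3-pseudomanifold is the whole link. -/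
theorem mem_of_triangle_subset_link (hK : NormalPM K 3) {u w a b c z : α} (huw : u ≠ w)
    (hab : a ≠ b) (hac : a ≠ c) (hbc : b ≠ c)
    (hau : a ≠ u) (haw : a ≠ w) (hbu : b ≠ u) (hbw : b ≠ w) (hcu : c ≠ u) (hcw : c ≠ w)
    (hzu : z ≠ u) (hzw : z ≠ w)
    (h1 : {u, w, a, b} ∈ K) (h2 : {u, w, a, c} ∈ K) (h3 : {u, w, b, c} ∈ K)
    (hz : {u, w, z} ∈ K) : z = a ∨ z = b ∨ z = c := by
  obtain ⟨hW, -, hN⟩ := hK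
  have down := hW.1.2.2
  have e3 : ∀ p, ({u, w} : Finset α) ∪ {p} = {u, w, p} := fun p => by
    rw [insert_union, singleton_union]
  have e4 : ∀ p q, insert q ({u, w, p} : Finset α) = {u, w, p, q} := fun p q => by
    ext; simp only [mem_insert, mem_singleton]; tauto
  have e4' : ∀ p q, ({u, w} : Finset α) ∪ {p, q} = {u, w, p, q} := fun p q => by
    rw [insert_union, singleton_union]
  have swap : ∀ p q, ({u, w, p, q} : Finset α) ∈ K → {u, w, q, p} ∈ K := fun p q h => by
    rwa [← pair_comm p q]
  have tri : ∀ p q, ({u, w, p, q} : Finset α) ∈ K → {u, w, p} ∈ K := fun p q h =>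
    down _ h _ (by rw [← e4]; exact subset_insert _ _) (by simp)
  have he : ({u, w} : Finset α) ∈ K :=
    down _ hz _ (by rw [← e3]; exact subset_union_left) (by simp)
  have hconn := (hN _ he (by rw [card_pair huw])).2
  have hvert : ∀ y, y ≠ u → y ≠ w → {u, w, y} ∈ K → y ∈ verts (link K {u, w}) := by
    intro y hyu hyw hy
    refine mem_verts.2 ⟨{y}, ?_, mem_singleton_self y⟩
    simp only [link, mem_filter, e3]
    exact ⟨down _ hy _ (by simp) (by simp), by simp [hyu, hyw], hy⟩
  have key : ∀ p q r y : α, p ≠ q → p ≠ r → q ≠ r → p ≠ u → p ≠ w → q ≠ u → q ≠ w → r ≠ u →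
      r ≠ w → {u, w, p, q} ∈ K → {u, w, p, r} ∈ K → p ≠ y → {p, y} ∈ link K {u, w} →
      y = q ∨ y = r := by
    intro p q r y hpq hpr hqr hpu hpw hqu hqw hru hrw hq hr hpy hy
    simp only [link, mem_filter, disjoint_insert_left, disjoint_singleton_left, mem_insert,
      mem_singleton, not_or, e4'] at hy
    refine eq_or_eq_of_coface hW (t := {u, w, p})
      (card_eq_three.2 ⟨u, w, p, huw, hpu.symm, hpw.symm, rfl⟩) ?_ ?_ ?_ hqr ?_ ?_ ?_
    · simp [hqu, hqw, hpq.symm]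
    · simp [hru, hrw, hpr.symm]
    · simp [hy.2.1.2, hpy.symm]
    · rwa [e4]
    · rwa [e4]
    · rw [e4]; exact hy.2.2
  have hpath := hconn a (hvert a hau haw (tri _ _ h1)) z (hvert z hzu hzw hz)
  clear hconn hvert hz hzu hzw
  induction hpath with
  | refl => exact Or.inl rfl
  | tail _ h ih =>
    rcases ih with rfl | rfl | rfl
    · exact Or.inr (key _ b c _ hab hac hbc hau haw hbu hbw hcu hcw h1 h2 h.1 h.2)
    · have := key _ a c _ hab.symm hbc hac hbu hbw hau haw hcu hcw (swap _ _ h1) h3 h.1 h.2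
      tauto
    · have := key _ a b _ hac.symm hbc.symm hab hcu hcw hau haw hbu hbw (swap _ _ h2)
        (swap _ _ h3) h.1 h.2
      tauto

end Complexes

section Chart

open NPM

variable {α : Type*} [DecidableEq α]

/-- A labelling of the vertices of `K` by `1, …, 8` under which the link of the vertex `8` is the
seven-vertex torus. -/
structure IsTorusChart (K : Complex α) (g : α → ℕ) (h : ℕ → α) : Prop where
  map_mem : ∀ x ∈ verts K, g x ∈ Icc 1 8
  left_inv : ∀ x ∈ verts K, h (g x) = x
  symm_mem : ∀ n ∈ Icc 1 8, h n ∈ verts K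
  right_inv : ∀ n ∈ Icc 1 8, g (h n) = n
  link_iff : ∀ t ⊆ Icc 1 7, t.Nonempty → ((insert 8 t).image h ∈ K ↔ t ∈ T7)

variable {K : Complex α}

theorem subset_of_mem_T7 {t : Finset ℕ} (ht : t ∈ T7) : t ⊆ Icc 1 7 := by
  rw [T7_eq, mem_genCx] at ht
  obtain ⟨-, σ, hσ, hs⟩ := ht
  obtain ⟨m, -, rfl⟩ := List.mem_map.1 (List.mem_toFinset.1 hσ)
  exact hs.trans (face_subset m)

theorem pair_mem_T7 : ∀ u ∈ Icc 1 7, ∀ w ∈ Icc 1 7, ({u, w} : Finset ℕ) ∈ T7 := by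
  have : ∀ u ∈ Icc 1 7, ∀ w ∈ Icc 1 7,
      ∃ σ ∈ (torus.map face).toFinset, ({u, w} : Finset ℕ) ⊆ σ := by decide +kernel
  intro u hu w hw
  rw [T7_eq, mem_genCx]
  exact ⟨by simp, this u hu w hw⟩

theorem mem_T7_iff {t : Finset ℕ} (ht : t.card = 3) : t ∈ T7 ↔ ∃ m ∈ torus, face m = t := by
  rw [T7_eq, mem_genCx]
  simp only [List.mem_toFinset, List.mem_map]
  constructor
  · rintro ⟨-, _, ⟨m, hm, rfl⟩, hs⟩
    exact ⟨m, hm, (eq_of_subset_of_card_le hs (by rw [card_face_torus m hm, ht])).symm⟩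
  · rintro ⟨m, hm, rfl⟩
    exact ⟨card_pos.1 (by omega), _, ⟨m, hm, rfl⟩, Subset.rfl⟩

theorem exists_isTorusChart (hK : IsComplex K) (hn : Neighbourly K) {v : α} (hv : {v} ∈ K)
    (hiso : Iso (link K {v}) T7) : ∃ g h, IsTorusChart K g h := by
  obtain ⟨f, hf, hT⟩ := hiso
  have hvV : v ∈ verts K := mem_verts.2 ⟨_, hv, mem_singleton_self v⟩
  have mem_link : ∀ τ, τ ∈ link K {v} ↔ τ ∈ K ∧ v ∉ τ ∧ insert v τ ∈ K := by
    intro τ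
    simp only [link, mem_filter, disjoint_singleton_right, insert_eq]
  have hW : ∀ x, x ∈ verts (link K {v}) ↔ x ∈ verts K ∧ x ≠ v := by
    intro x
    constructor
    · intro hx
      obtain ⟨τ, hτ, hxτ⟩ := mem_verts.1 hx
      rw [mem_link] at hτ
      exact ⟨subset_verts hτ.1 hxτ, fun h => hτ.2.1 (h ▸ hxτ)⟩
    · rintro ⟨hx, hxv⟩
      have hvx := hn v hvV x hx hxv.symm
      refine mem_verts.2 ⟨{x}, (mem_link _).2 ⟨?_, by simpa using hxv.symm, hvx⟩, by simp⟩
      exact hK.2.2 _ hvx _ (by simp) (by simp)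
  have hfmem : ∀ x ∈ verts (link K {v}), f x ∈ Icc 1 7 := by
    intro x hx
    obtain ⟨τ, hτ, hxτ⟩ := mem_verts.1 hx
    exact subset_of_mem_T7 (hT ▸ mem_image_of_mem (image f) hτ) (mem_image_of_mem f hxτ)
  have hfsurj : ∀ n ∈ Icc 1 7, ∃ x ∈ verts (link K {v}), f x = n := by
    intro n hn
    have := pair_mem_T7 n hn n hn
    rw [hT, mem_image] at this
    obtain ⟨τ, hτ, hn'⟩ := this
    have : n ∈ τ.image f := by simp [hn']
    obtain ⟨x, hx, rfl⟩ := mem_image.1 this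
    exact ⟨x, mem_verts.2 ⟨τ, hτ, hx⟩, rfl⟩
  have : Nonempty α := ⟨v⟩
  choose! k hk hfk using hfsurj
  have hkf : ∀ x ∈ verts (link K {v}), k (f x) = x := fun x hx =>
    hf (hk _ (hfmem x hx)) hx (hfk _ (hfmem x hx))
  have hlt : ∀ n ∈ Icc 1 7, n ≠ 8 := fun n hn => by rw [mem_Icc] at hn; omega
  have hle : ∀ n ∈ Icc 1 8, n = 8 ∨ n ∈ Icc 1 7 := fun n hn => by
    rw [mem_Icc] at hn ⊢; omega
  have hsub : Icc 1 7 ⊆ Icc 1 8 := Icc_subset_Icc le_rfl (by omega)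
  refine ⟨fun x => if x = v then 8 else f x, fun n => if n = 8 then v else k n,
    ⟨?_, ?_, ?_, ?_, ?_⟩⟩
  · intro x hx
    by_cases hxv : x = v
    · simp [hxv]
    · simpa only [if_neg hxv] using hsub (hfmem x ((hW x).2 ⟨hx, hxv⟩))
  · intro x hx
    by_cases hxv : x = v
    · simp [hxv]
    · have hx' := (hW x).2 ⟨hx, hxv⟩
      simp only [if_neg hxv, if_neg (hlt _ (hfmem x hx')), hkf x hx']
  · intro n hn
    rcases hle n hn with rfl | hn
    · simpa using hvV
    · simpa only [if_neg (hlt n hn)] using ((hW _).1 (hk n hn)).1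
  · intro n hn
    rcases hle n hn with rfl | hn
    · simp
    · simp only [if_neg (hlt n hn), if_neg ((hW _).1 (hk n hn)).2, hfk n hn]
  · intro t ht htn
    have himg : (insert 8 t).image (fun n => if n = 8 then v else k n) =
        insert v (t.image k) := by
      rw [image_insert, if_pos rfl]
      congr 1
      exact image_congr fun n hn => if_neg (hlt n (ht hn))
    have hfkt : (t.image k).image f = t := by
      rw [image_image]
      conv_rhs => rw [← image_id (s := t)]
      exact image_congr fun n hn => hfk n (ht hn)
    rw [himg, hT, mem_image]
    constructor
    · intro hmem
      refine ⟨t.image k, (mem_link _).2 ⟨?_, ?_, hmem⟩, hfkt⟩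
      · exact hK.2.2 _ hmem _ (subset_insert _ _) (htn.image k)
      · intro hvt
        obtain ⟨n, hn, hnv⟩ := mem_image.1 hvt
        exact ((hW _).1 (hk n (ht hn))).2 hnv
    · rintro ⟨τ, hτ, rfl⟩
      have : (τ.image f).image k = τ := by
        rw [image_image]
        conv_rhs => rw [← image_id (s := τ)]
        exact image_congr fun x hx => hkf x (subset_verts hτ hx)
      rw [this]
      exact ((mem_link τ).1 hτ).2.2

namespace IsTorusChart

variable {g : α → ℕ} {h : ℕ → α}

theorem injOn (hc : IsTorusChart K g h) : Set.InjOn h (Icc 1 8 : Finset ℕ) :=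
  fun x hx y hy hxy => by rw [← hc.right_inv x hx, hxy, hc.right_inv y hy]

theorem card_image (hc : IsTorusChart K g h) {s : Finset ℕ} (hs : s ⊆ Icc 1 8) :
    (s.image h).card = s.card :=
  card_image_of_injOn (hc.injOn.mono (coe_subset.2 hs))

theorem image_image_self (hc : IsTorusChart K g h) {s : Finset ℕ} (hs : s ⊆ Icc 1 8) :
    (s.image h).image g = s := by
  rw [image_image]
  conv_rhs => rw [← image_id (s := s)]
  exact image_congr fun n hn => hc.right_inv n (hs hn)

theorem exists_eq_image (hc : IsTorusChart K g h) {σ : Finset α} (hσ : σ ∈ K) :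
    ∃ s ⊆ Icc 1 8, s.image h = σ := by
  refine ⟨σ.image g, ?_, ?_⟩
  · intro n hn
    obtain ⟨x, hx, rfl⟩ := mem_image.1 hn
    exact hc.map_mem x (subset_verts hσ hx)
  · rw [image_image]
    conv_rhs => rw [← image_id (s := σ)]
    exact image_congr fun x hx => hc.left_inv x (subset_verts hσ hx)

theorem Icc_seven_subset : Icc 1 7 ⊆ Icc 1 8 := Icc_subset_Icc le_rfl (by omega)

theorem card_extensions (hc : IsTorusChart K g h) (hK : WeakPM K 3) {t : Finset ℕ}
    (ht : t ⊆ Icc 1 7) (hcard : t.card = 3) :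
    ((Icc 1 7 \ t).filter fun x => (insert x t).image h ∈ K).card ∈
      if t ∈ T7 then [1] else [0, 2] := by
  have ht8 := ht.trans Icc_seven_subset
  have heq : ((Icc 1 8 \ t).filter fun x => (insert x t).image h ∈ K).card =
      ((verts K \ t.image h).filter fun x => insert x (t.image h) ∈ K).card := by
    refine card_bij (fun x _ => h x) ?_ ?_ ?_
    · intro x hx
      simp only [mem_filter, mem_sdiff, image_insert] at hx ⊢
      refine ⟨⟨hc.symm_mem x hx.1.1, fun hm => ?_⟩, hx.2⟩
      obtain ⟨y, hy, hyx⟩ := mem_image.1 hm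
      exact hx.1.2 (hc.injOn (ht8 hy) hx.1.1 hyx ▸ hy)
    · intro x hx y hy
      simp only [mem_filter, mem_sdiff] at hx hy
      exact hc.injOn hx.1.1 hy.1.1
    · intro x hx
      simp only [mem_filter, mem_sdiff] at hx
      refine ⟨g x, ?_, hc.left_inv x hx.1.1⟩
      simp only [mem_filter, mem_sdiff, image_insert, hc.left_inv x hx.1.1]
      exact ⟨⟨hc.map_mem x hx.1.1, fun hm => hx.1.2
        (by simpa only [hc.left_inv x hx.1.1] using mem_image_of_mem h hm)⟩, hx.2⟩
  have hsplit : Icc 1 8 \ t = insert 8 (Icc 1 7 \ t) := by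
    rw [← insert_sdiff_of_notMem _ fun h8 => by simpa using ht h8]
    exact congrArg (· \ t) (by decide)
  have h02 := card_cofaces hK ((hc.card_image ht8).trans hcard)
  have hlink := hc.link_iff t ht (card_pos.1 (by omega))
  rw [← heq, hsplit, filter_insert] at h02
  split_ifs with hT
  · rw [if_pos (hlink.2 hT), card_insert_of_notMem (by simp)] at h02
    rw [List.mem_singleton]
    omega
  · rw [if_neg fun h => hT (hlink.1 h)] at h02
    simpa using h02

theorem card_erasures (hc : IsTorusChart K g h) (hK : NormalPM K 3) {p : Finset ℕ}
    (hp : p ⊆ Icc 1 7) (hcard : p.card = 5) :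
    (p.filter fun x => (p.erase x).image h ∈ K).card ≤ 2 := by
  by_contra! hlt
  obtain ⟨a, ha, b, hb, c, hcc, hab, hac, hbc⟩ := two_lt_card.1 hlt
  rw [mem_filter] at ha hb hcc
  have h2 : (((p.erase a).erase b).erase c).card = 2 := by
    rw [card_erase_of_mem, card_erase_of_mem, card_erase_of_mem ha.1, hcard]
    · exact mem_erase.2 ⟨hab.symm, hb.1⟩
    · exact mem_erase.2 ⟨hbc.symm, mem_erase.2 ⟨hac.symm, hcc.1⟩⟩
  obtain ⟨u, w, huw, heq⟩ := card_eq_two.1 h2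
  have hmem : ∀ x, x ≠ c ∧ x ≠ b ∧ x ≠ a ∧ x ∈ p ↔ x = u ∨ x = w := by
    intro x
    simpa only [mem_erase, mem_insert, mem_singleton] using Finset.ext_iff.1 heq x
  obtain ⟨huc, hub, hua, hu⟩ := (hmem u).2 (Or.inl rfl)
  obtain ⟨hwc, hwb, hwa, hw⟩ := (hmem w).2 (Or.inr rfl)
  have face_eq : ∀ x y z, x ∈ p → y ∈ p → x ≠ y → x ≠ z → y ≠ z →
      (∀ n, n = x ∨ n = y ∨ n = z ↔ n = a ∨ n = b ∨ n = c) →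
      (p.erase z).image h ∈ K → ({h u, h w, h x, h y} : Finset α) ∈ K := by
    intro x y z hx hy hxy hxz hyz hall hz
    have : p.erase z = {u, w, x, y} := by
      ext n
      have h1 := hmem n
      have h2 := hall n
      have h3 := hall u
      have h4 := hall w
      simp only [mem_erase, mem_insert, mem_singleton]
      grind
    simpa [this, image_insert] using hz
  have hinj : ∀ x ∈ p, ∀ y ∈ p, x ≠ y → h x ≠ h y := fun x hx y hy hxy he =>
    hxy (hc.injOn (Icc_seven_subset (hp hx)) (Icc_seven_subset (hp hy)) he)
  have h8 : (8 : ℕ) ∈ Icc 1 8 := by simp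
  have hinj8 : ∀ x ∈ p, h 8 ≠ h x := fun x hx he => by
    have := hc.injOn h8 (Icc_seven_subset (hp hx)) he
    have := mem_Icc.1 (hp hx)
    omega
  have huw8 : ({h u, h w, h 8} : Finset α) ∈ K := by
    have := (hc.link_iff {u, w} (by simp [insert_subset_iff, hp hu, hp hw]) (by simp)).2
      (pair_mem_T7 u (hp hu) w (hp hw))
    rw [image_insert, image_insert, image_singleton] at this
    rwa [pair_comm (h w), insert_comm]
  rcases mem_of_triangle_subset_link hK (hinj u hu w hw huw) (hinj a ha.1 b hb.1 hab)
    (hinj a ha.1 c hcc.1 hac) (hinj b hb.1 c hcc.1 hbc) (hinj a ha.1 u hu hua.symm)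
    (hinj a ha.1 w hw hwa.symm) (hinj b hb.1 u hu hub.symm) (hinj b hb.1 w hw hwb.symm)
    (hinj c hcc.1 u hu huc.symm) (hinj c hcc.1 w hw hwc.symm) (hinj8 u hu) (hinj8 w hw)
    (face_eq a b c ha.1 hb.1 hab hac hbc (fun n => by tauto) hcc.2)
    (face_eq a c b ha.1 hcc.1 hac hab hbc.symm (fun n => by tauto) hb.2)
    (face_eq b c a hb.1 hcc.1 hbc hab.symm hac.symm (fun n => by tauto) ha.2)
    huw8 with he | he | he
  exacts [hinj8 a ha.1 he, hinj8 b hb.1 he, hinj8 c hcc.1 he]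

theorem countP_eq_card_filter {l : List ℕ} (hl : l.Nodup) (S : ℕ → Bool) :
    l.countP S = (l.toFinset.filter fun x => S x = true).card := by
  rw [List.countP_eq_length_filter, ← List.toFinset_card_of_nodup (hl.filter _),
    List.toFinset_filter]

theorem nodup_bitsIn (m : ℕ) : (bitsIn m).Nodup := List.Nodup.filter _ (by decide)

theorem nodup_bitsOut (m : ℕ) : (bitsOut m).Nodup := List.Nodup.filter _ (by decide)

theorem toFinset_bitsOut (m : ℕ) : (bitsOut m).toFinset = Icc 1 7 \ face m := by
  have h7 : Icc 1 7 = [1, 2, 3, 4, 5, 6, 7].toFinset := by decide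
  ext x
  rw [h7]
  simp only [face, bitsIn, bitsOut, List.mem_toFinset, List.mem_filter, mem_sdiff,
    Bool.not_eq_true']
  grind

theorem satisfies_near (hc : IsTorusChart K g h) (hK : NormalPM K 3) :
    ∀ q ∈ quads, ∀ c ∈ near q, Satisfies (fun m => decide ((face m).image h ∈ K)) c := by
  intro q hq c hcq
  rw [near, List.mem_append, List.mem_map, List.mem_map] at hcq
  rcases hcq with ⟨x, hx, rfl⟩ | ⟨x, hx, rfl⟩
  · obtain ⟨h1, h2, h3⟩ := triple_data q hq x hx
    generalize q - 2 ^ x = t at h1 h2 h3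
    have key := hc.card_extensions hK.1 (face_subset t) h1
    have hT : face t ∈ T7 ↔ torus.contains t = true := by
      rw [mem_T7_iff h1, List.contains_iff_mem]
      exact ⟨fun ⟨m, hm, he⟩ => h2 m hm he ▸ hm, fun hm => ⟨t, hm, rfl⟩⟩
    simp only [hT] at key
    rw [Satisfies, tripleConstraint, List.countP_map,
      countP_eq_card_filter (nodup_bitsOut t), toFinset_bitsOut]
    convert key using 2
    refine filter_congr fun y hy => ?_
    rw [← toFinset_bitsOut, List.mem_toFinset] at hy
    simp only [Function.comp, decide_eq_true_eq, h3 y hy]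
  · obtain ⟨h1, h2⟩ := pent_data q hq x hx
    generalize q + 2 ^ x = p at h1 h2
    have key := hc.card_erasures hK (face_subset p) h1
    have hle : ∀ n, n ≤ 2 → n ∈ [0, 1, 2] := by simp; omega
    rw [Satisfies, pentConstraint, List.countP_map,
      countP_eq_card_filter (nodup_bitsIn p)]
    refine hle _ (le_trans (le_of_eq ?_) key)
    congr 1
    refine filter_congr fun y hy => ?_
    simp only [Function.comp, decide_eq_true_eq, h2 y (List.mem_toFinset.1 hy)]

theorem image_mem_iff (hc : IsTorusChart K g h) {t : Finset ℕ} (ht : t ⊆ Icc 1 7)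
    (hcard : t.card = 3) : (insert 8 t).image h ∈ K ↔ ∃ m ∈ torus, face m = t := by
  rw [hc.link_iff t ht (card_pos.1 (by omega)), mem_T7_iff hcard]

theorem eight_notMem_face (m : ℕ) : 8 ∉ face m := fun h => by simpa using face_subset m h

theorem image_affine_insert {p : ℕ × ℕ} {m : ℕ} (hp : p ∈ affineParams) (hm : m ∈ torus) :
    (insert 8 (face m)).image (affine p) = insert 8 (face (affineMask p m)) := by
  rw [image_insert, (image_affine_torus p hp m hm).1]
  rfl

theorem image_facets (hc : IsTorusChart K g h) {p : ℕ × ℕ} (hp : p ∈ affineParams)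
    {G : List ℕ} (hG : G ∈ models)
    (hiff : ∀ q ∈ quads, ((face q).image h ∈ K ↔ affineMask p q ∈ G)) :
    (facets K 3).image (image (affine p ∘ g)) = modelFacets G := by
  have himg : ∀ s ⊆ Icc 1 8, (s.image h).image (affine p ∘ g) = s.image (affine p) := by
    intro s hs
    rw [← image_image, hc.image_image_self hs]
  have hface8 : ∀ m, insert 8 (face m) ⊆ Icc 1 8 := fun m =>
    insert_subset (by simp) ((face_subset m).trans Icc_seven_subset)
  ext s
  simp only [modelFacets, mem_union, List.mem_toFinset, List.mem_map, mem_image, facets,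
    mem_filter]
  constructor
  · rintro ⟨σ, ⟨hσ, hcard⟩, rfl⟩
    obtain ⟨s, hs, rfl⟩ := hc.exists_eq_image hσ
    rw [hc.card_image hs] at hcard
    rw [himg s hs]
    have hsub : ∀ x ∈ s, x ≠ 8 → x ∈ Icc 1 7 := by
      intro x hx hx8
      have := hs hx
      rw [mem_Icc] at this ⊢
      omega
    by_cases h8 : 8 ∈ s
    · left
      have ht : s.erase 8 ⊆ Icc 1 7 := fun x hx =>
        hsub x (mem_of_mem_erase hx) (ne_of_mem_erase hx)
      rw [← insert_erase h8] at hσ ⊢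
      obtain ⟨m, hm, he⟩ :=
        (hc.image_mem_iff ht (by rw [card_erase_of_mem h8, hcard])).1 hσ
      rw [← he, image_affine_insert hp hm]
      exact ⟨_, (image_affine_torus p hp m hm).2, rfl⟩
    · right
      obtain ⟨q, hq, rfl⟩ := exists_quad s (mem_powersetCard.2
        ⟨fun x hx => hsub x hx fun he => h8 (he ▸ hx), hcard⟩)
      exact ⟨_, (hiff q hq).1 hσ, (image_affine_quad p hp q hq).symm⟩
  · rintro (⟨m, hm, rfl⟩ | ⟨m, hm, rfl⟩)
    · obtain ⟨m', hm', rfl⟩ := exists_affineMask_torus p hp m hm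
      refine ⟨(insert 8 (face m')).image h, ⟨?_, ?_⟩, ?_⟩
      · exact (hc.image_mem_iff (face_subset m') (card_face_torus m' hm')).2 ⟨m', hm', rfl⟩
      · rw [hc.card_image (hface8 m'), card_insert_of_notMem (eight_notMem_face m'),
          card_face_torus m' hm']
      · rw [himg _ (hface8 m'), image_affine_insert hp hm']
    · obtain ⟨q, hq, rfl⟩ := exists_affineMask_quad p hp G hG m hm
      have hq8 := (face_subset q).trans Icc_seven_subset
      refine ⟨(face q).image h, ⟨(hiff q hq).2 hm, ?_⟩, ?_⟩
      · rw [hc.card_image hq8, card_face_quad q hq]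
      · rw [himg _ hq8, image_affine_quad p hp q hq]

theorem exists_iso (hc : IsTorusChart K g h) (hK : NormalPM K 3) :
    ∃ G ∈ models, Iso K (genCx (modelFacets G)) := by
  obtain ⟨p, hp, G, hG, hiff⟩ := exists_model (hc.satisfies_near hK)
  refine ⟨G, hG, affine p ∘ g, ?_, ?_⟩
  · intro x hx y hy hxy
    rw [← hc.left_inv x hx, ← hc.left_inv y hy,
      affine_mem p hp _ (hc.map_mem x hx) _ (hc.map_mem y hy) hxy]
  · rw [← hc.image_facets hp hG fun q hq => by simpa using hiff q hq, genCx_image,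
      ← eq_genCx_facets hK.1.1 hK.1.2.1]

end IsTorusChart

end Chart

end TorusLink

/-- a neighbourly normal 3-pseudomanifold on 8 vertices having a
vertex whose link is isomorphic to the 7-vertex torus `T` is isomorphic to
`N_1`, `N_2`, `N_3` or `N_4`. -/
theorem statement12 {α : Type u} [DecidableEq α] (K : NPM.Complex α)
    (h1 : NPM.NormalPM K 3) (h2 : NPM.Neighbourly K)
    (h3 : (NPM.verts K).card = 8)
    (h4 : ∃ v, ({v} : Finset α) ∈ K ∧ NPM.Iso (NPM.link K {v}) T7) :
    NPM.Iso K N1 ∨ NPM.Iso K N2 ∨ NPM.Iso K N3 ∨ NPM.Iso K N4 := by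
  obtain ⟨v, hv, hiso⟩ := h4
  obtain ⟨g, h, hc⟩ := TorusLink.exists_isTorusChart h1.1.1 h2 hv hiso
  obtain ⟨G, hG, hGiso⟩ := hc.exists_iso h1
  rw [TorusLink.N1_eq, TorusLink.N2_eq, TorusLink.N3_eq, TorusLink.N4_eq]
  simp only [TorusLink.models, List.mem_cons, List.not_mem_nil, or_false] at hG
  rcases hG with rfl | rfl | rfl | rfl
  exacts [Or.inl hGiso, Or.inr (Or.inl hGiso), Or.inr (Or.inr (Or.inl hGiso)),
    Or.inr (Or.inr (Or.inr hGiso))]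
end
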